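/- arXiv:0806.0606 — 4 statements merged into one kernel-verified Lean document; each statement's English description precedes it below -/
import Mathlib

section
/- For every ε > 0, the integral of ζ_s over P ∖ B_ε(m) tends to 0 as s → ∞; i.e. the normalized densities ζ_s concentrate at m (they form a Dirac sequence). -/
open MeasureTheory Filter Set
open scoped RealInnerProductSpace Topology

/-- The gradient of a `C²` function on an open set is differentiable there. -/
lemma ContDiffOn.differentiableAt_gradient {E : Type*} [NormedAddCommGroup E]
    [InnerProductSpace ℝ E] [CompleteSpace E] {U : Set E} (hU : IsOpen U) {ψ : E → ℝ}
    (hψ : ContDiffOn ℝ 2 ψ U) {x : E} (hx : x ∈ U) : DifferentiableAt ℝ (gradient ψ) x := by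
  have h : DifferentiableAt ℝ (fderiv ℝ ψ) x :=
    ((hψ.fderiv_of_isOpen (m := 1) hU (by norm_num)).differentiableOn
      (by norm_num)).differentiableAt (hU.mem_nhds hx)
  exact (InnerProductSpace.toDual ℝ E).symm.toContinuousLinearEquiv.differentiableAt.comp x h

/-- The derivative of `x ↦ ⟪x - m, ∇ψ x⟫ - ψ x` only involves the Hessian of `ψ`. -/
lemma hasFDerivAt_inner_gradient_sub {E : Type*} [NormedAddCommGroup E]
    [InnerProductSpace ℝ E] [CompleteSpace E] {ψ : E → ℝ} {m x : E}
    (hψ : DifferentiableAt ℝ ψ x) (hg : DifferentiableAt ℝ (gradient ψ) x) :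
    HasFDerivAt (fun y => ⟪y - m, gradient ψ y⟫ - ψ y)
      ((innerSL ℝ (x - m)).comp (fderiv ℝ (gradient ψ) x)) x := by
  have h := (((hasFDerivAt_id x).sub_const m).inner ℝ hg.hasFDerivAt).sub
    hψ.hasGradientAt.hasFDerivAt
  refine h.congr_fderiv ?_
  ext v
  simp [inner_sub_left]

/-- If the Hessian of `ψ` is at least `2c`, then `x ↦ ⟪x - m, ∇ψ x⟫ - ψ x` grows at least
quadratically away from `m`. -/
lemma add_mul_norm_sq_le_inner_gradient_sub {E : Type*} [NormedAddCommGroup E]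
    [InnerProductSpace ℝ E] [CompleteSpace E] {U : Set E} (hUopen : IsOpen U)
    (hUconv : Convex ℝ U) {ψ : E → ℝ} (hψ : ContDiffOn ℝ 2 ψ U) {c : ℝ}
    (hHess : ∀ x ∈ U, ∀ v : E, 2 * c * ‖v‖ ^ 2 ≤ ⟪v, fderiv ℝ (gradient ψ) x v⟫)
    {m x : E} (hm : m ∈ U) (hx : x ∈ U) :
    -ψ m + c * ‖x - m‖ ^ 2 ≤ ⟪x - m, gradient ψ x⟫ - ψ x := by
  set v := x - m with hv
  let F : E → ℝ := fun y => ⟪y - m, gradient ψ y⟫ - ψ y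
  let g : ℝ → ℝ := fun t => F (m + t • v) - c * ‖v‖ ^ 2 * t ^ 2
  have hmem : ∀ t ∈ Icc (0 : ℝ) 1, m + t • v ∈ U := fun t ht =>
    hUconv.add_smul_sub_mem hm hx ht
  have hderiv : ∀ t ∈ Icc (0 : ℝ) 1, HasDerivAt g
      (t * (⟪v, fderiv ℝ (gradient ψ) (m + t • v) v⟫ - 2 * c * ‖v‖ ^ 2)) t := by
    intro t ht
    have hF : HasFDerivAt F _ (m + t • v) := hasFDerivAt_inner_gradient_sub (m := m)
      ((hψ.differentiableOn (by norm_num)).differentiableAt (hUopen.mem_nhds (hmem t ht)))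
      (hψ.differentiableAt_gradient hUopen (hmem t ht))
    have hline : HasDerivAt (fun t : ℝ => m + t • v) v t := by
      simpa using ((hasDerivAt_id t).smul_const v).const_add m
    have h := (hF.comp_hasDerivAt t hline).sub
      (((hasDerivAt_id t).pow 2).const_mul (c * ‖v‖ ^ 2))
    refine h.congr_deriv ?_
    simp
    ring
  have hmono : MonotoneOn g (Icc 0 1) := by
    refine monotoneOn_of_deriv_nonneg (convex_Icc 0 1)
      (fun t ht => (hderiv t ht).continuousAt.continuousWithinAt)
      (fun t ht => (hderiv t (interior_subset ht)).differentiableAt.differentiableWithinAt) ?_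
    intro t ht
    have ht' := interior_subset ht
    rw [(hderiv t ht').deriv]
    exact mul_nonneg ht'.1 (sub_nonneg.2 (hHess _ (hmem t ht') v))
  have h := hmono (left_mem_Icc.2 zero_le_one) (right_mem_Icc.2 zero_le_one) zero_le_one
  simp only [g, F, hv, zero_smul, one_smul, add_zero, sub_self, inner_zero_left,
    add_sub_cancel] at h
  simp only [hv]
  linarith

/-- A convex set of positive measure has positive measure near each of its points. -/
lemma Convex.measure_inter_ball_pos {E : Type*} [NormedAddCommGroup E] [NormedSpace ℝ E]
    [MeasurableSpace E] [BorelSpace E] [FiniteDimensional ℝ E] (μ : Measure E)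
    [μ.IsAddHaarMeasure] {P : Set E} (hP : Convex ℝ P) (hμ : μ P ≠ 0) {m : E} (hm : m ∈ P)
    {δ : ℝ} (hδ : 0 < δ) : 0 < μ (P ∩ Metric.ball m δ) := by
  have hint : (interior P).Nonempty := by
    by_contra hemp
    rw [not_nonempty_iff_eq_empty] at hemp
    refine hμ (measure_mono_null (fun x hx => ?_) (hP.addHaar_frontier μ))
    exact ⟨subset_closure hx, by simp [hemp]⟩
  have hmc : m ∈ closure (interior P) := by
    rw [hP.closure_interior_eq_closure_of_nonempty_interior hint]
    exact subset_closure hm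
  have hne : (interior P ∩ Metric.ball m δ).Nonempty := by
    rw [inter_comm]
    exact mem_closure_iff.1 hmc _ Metric.isOpen_ball (Metric.mem_ball_self hδ)
  exact ((isOpen_interior.inter Metric.isOpen_ball).measure_pos μ hne).trans_le
    (measure_mono (inter_subset_inter_left _ interior_subset))

/-- Laplace-type concentration: if `f` is at least `b` on `A ⊆ P` and at most `a < b` on a
subset `B ⊆ P` of positive measure, then the normalized mass of `exp (-s f)` on `A` vanishes
as `s → ∞`. -/
lemma tendsto_setIntegral_exp_neg_div_zero {E : Type*} [MeasurableSpace E] {μ : Measure E}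
    {P A B : Set E} {f : E → ℝ} {a b : ℝ} (hab : a < b)
    (hint : ∀ s : ℝ, IntegrableOn (fun x => Real.exp (-(s * f x))) P μ)
    (hPfin : μ P ≠ ⊤) (hA : MeasurableSet A) (hAP : A ⊆ P) (hB : MeasurableSet B)
    (hBP : B ⊆ P) (hBpos : 0 < μ B) (hfA : ∀ x ∈ A, b ≤ f x) (hfB : ∀ x ∈ B, f x ≤ a) :
    Tendsto (fun s : ℝ => ∫ x in A, Real.exp (-(s * f x)) / ∫ y in P, Real.exp (-(s * f y)) ∂μ ∂μ)
      atTop (𝓝 0) := by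
  have hAfin : μ A ≠ ⊤ := measure_ne_top_of_subset hAP hPfin
  have hBfin : μ B ≠ ⊤ := measure_ne_top_of_subset hBP hPfin
  have hBreal : 0 < μ.real B := ENNReal.toReal_pos hBpos.ne' hBfin
  have hlim : Tendsto (fun s : ℝ => μ.real A / μ.real B * Real.exp (-((b - a) * s)))
      atTop (𝓝 0) := by
    have h := Real.tendsto_exp_neg_atTop_nhds_zero.comp
      (tendsto_id.const_mul_atTop (sub_pos.2 hab))
    simpa using h.const_mul (μ.real A / μ.real B)
  refine tendsto_of_tendsto_of_tendsto_of_le_of_le' tendsto_const_nhds hlim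
    (Eventually.of_forall fun s => ?_) ?_
  · exact integral_nonneg fun x => div_nonneg (Real.exp_pos _).le
      (integral_nonneg fun y => (Real.exp_pos _).le)
  filter_upwards [eventually_ge_atTop 0] with s hs
  have hnum : ∫ x in A, Real.exp (-(s * f x)) ∂μ ≤ μ.real A * Real.exp (-(s * b)) := by
    refine (setIntegral_mono_on ((hint s).mono_set hAP) (integrableOn_const hAfin) hA
      (g := fun _ => Real.exp (-(s * b))) fun x hx => ?_).trans_eq (by simp)
    have := mul_le_mul_of_nonneg_left (hfA x hx) hs
    gcongr
  have hden : μ.real B * Real.exp (-(s * a)) ≤ ∫ y in P, Real.exp (-(s * f y)) ∂μ := by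
    calc μ.real B * Real.exp (-(s * a)) = ∫ y in B, Real.exp (-(s * a)) ∂μ := by simp
      _ ≤ ∫ y in B, Real.exp (-(s * f y)) ∂μ := by
        refine setIntegral_mono_on (integrableOn_const hBfin) ((hint s).mono_set hBP) hB
          fun x hx => ?_
        have := mul_le_mul_of_nonneg_left (hfB x hx) hs
        gcongr
      _ ≤ ∫ y in P, Real.exp (-(s * f y)) ∂μ :=
        setIntegral_mono_set (hint s) (ae_of_all _ fun _ => (Real.exp_pos _).le)
          hBP.eventuallyLE
  rw [integral_div]
  calc _ ≤ μ.real A * Real.exp (-(s * b)) / (μ.real B * Real.exp (-(s * a))) := by gcongr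
    _ = μ.real A / μ.real B * Real.exp (-((b - a) * s)) := by
      rw [mul_div_mul_comm, ← Real.exp_sub]
      congr 2
      ring

/-- With `P`, `m`, `ψ`, `c` and `f_m` as in the context (compact convex `P ⊆ U`, `ψ` of class
`C²` on the open convex neighborhood `U` with `Hess ψ ≥ 2c·Id`, and
`f_m(x) = ⟨x − m, ∇ψ(x)⟩ − ψ(x)`), the normalized densities
`ζ_s(x) = e^{−s f_m(x)} / ∫_P e^{−s f_m}` concentrate at `m`: for every `ε > 0`,
`∫_{P ∖ B_ε(m)} ζ_s → 0` as `s → ∞`. -/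
theorem dirac_sequence_concentration {n : ℕ}
    (U P : Set (EuclideanSpace ℝ (Fin n)))
    (hUopen : IsOpen U) (hUconv : Convex ℝ U)
    (hPU : P ⊆ U) (hPcomp : IsCompact P) (hPconv : Convex ℝ P)
    (m : EuclideanSpace ℝ (Fin n)) (hm : m ∈ P)
    (ψ : EuclideanSpace ℝ (Fin n) → ℝ) (hψ : ContDiffOn ℝ 2 ψ U)
    (c : ℝ) (hc : 0 < c)
    (hHess : ∀ x ∈ U, ∀ v : EuclideanSpace ℝ (Fin n),
      2 * c * ‖v‖ ^ 2 ≤ ⟪v, fderiv ℝ (gradient ψ) x v⟫)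
    (f : EuclideanSpace ℝ (Fin n) → ℝ)
    (hf : ∀ x, f x = ⟪x - m, gradient ψ x⟫ - ψ x)
    (ζ : ℝ → EuclideanSpace ℝ (Fin n) → ℝ)
    (hζ : ∀ s x, ζ s x = Real.exp (-(s * f x)) / ∫ y in P, Real.exp (-(s * f y))) :
    ∀ ε > 0,
      Tendsto (fun s : ℝ => ∫ x in P \ Metric.ball m ε, ζ s x) atTop (𝓝 0) := by
  intro ε hε
  have hfm : f m = -ψ m := by simp [hf]
  have hcont : ContinuousOn f P := fun x hx => by
    rw [funext hf]
    exact (hasFDerivAt_inner_gradient_sub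
      ((hψ.differentiableOn (by norm_num)).differentiableAt (hUopen.mem_nhds (hPU hx)))
      (hψ.differentiableAt_gradient hUopen (hPU hx))).continuousAt.continuousWithinAt
  simp only [hζ]
  rcases eq_or_ne (volume P) 0 with hP0 | hP0
  · have h0 : volume.restrict (P \ Metric.ball m ε) = 0 :=
      Measure.restrict_eq_zero.2 (measure_mono_null sdiff_subset hP0)
    simp [h0]
  have hlt : f m < f m + c * ε ^ 2 / 2 := by
    have : 0 < c * ε ^ 2 := by positivity
    linarith
  obtain ⟨δ, hδ, hball⟩ := Metric.mem_nhdsWithin_iff.1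
    ((hcont m hm).eventually_lt_const hlt)
  refine tendsto_setIntegral_exp_neg_div_zero (B := P ∩ Metric.ball m δ)
    (a := f m + c * ε ^ 2 / 2) (b := f m + c * ε ^ 2) (by linarith)
    (fun s => ContinuousOn.integrableOn_compact hPcomp (by fun_prop)) hPcomp.measure_ne_top
    (hPcomp.measurableSet.diff Metric.isOpen_ball.measurableSet) sdiff_subset
    (hPcomp.measurableSet.inter Metric.isOpen_ball.measurableSet) inter_subset_left
    (hPconv.measure_inter_ball_pos volume hP0 hm hδ) (fun x hx => ?_)
    (fun x hx => le_of_lt (hball ⟨hx.2, hx.1⟩))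
  have hgrow := add_mul_norm_sq_le_inner_gradient_sub hUopen hUconv hψ hHess (hPU hm) (hPU hx.1)
  have hdist : ε ≤ ‖x - m‖ := by
    simpa [dist_eq_norm] using hx.2
  have : c * ε ^ 2 ≤ c * ‖x - m‖ ^ 2 := by gcongr
  rw [hfm, hf x]
  linarith
end

section
/- The rescaled Legendre transforms κ_s converge to ∇ψ pointwise on int P and uniformly on every compact subset C ⊂ int P. Moreover, assuming each κ_s : int P → ℝⁿ (s > 0) is a bijection, the inverses κ_s^{−1} converge uniformly on ∇ψ(C) to the inverse of ∇ψ|_{int P}, for every compact C ⊂ int P. -/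
open Filter Set
open scoped RealInnerProductSpace Topology BigOperators

section Legendre

variable {E : Type*} [NormedAddCommGroup E] [InnerProductSpace ℝ E]

/-- A point of the interior of a polyhedron satisfies strictly every constraint whose normal
is nonzero whenever the constraint is active. -/
lemma polyhedron_interior_pos {ι : Type*} {ν : ι → E} {lam : ι → ℝ} {x : E}
    (hx : x ∈ interior {x : E | ∀ r, 0 ≤ ⟪ν r, x⟫ - lam r}) (r : ι)
    (hν : ⟪ν r, x⟫ - lam r = 0 → ν r ≠ 0) : 0 < ⟪ν r, x⟫ - lam r := by
  refine lt_of_le_of_ne (interior_subset hx r) fun h0 => ?_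
  have hne := hν h0.symm
  have hcont : Tendsto (fun t : ℝ => x - t • ν r) (𝓝[>] 0) (𝓝 x) := by
    have : Continuous fun t : ℝ => x - t • ν r := by fun_prop
    simpa using (this.tendsto 0).mono_left nhdsWithin_le_nhds
  obtain ⟨t, ht, htpos⟩ :=
    ((hcont.eventually (mem_interior_iff_mem_nhds.1 hx)).and self_mem_nhdsWithin).exists
  have h1 : 0 ≤ ⟪ν r, x - t • ν r⟫ - lam r := ht r
  rw [inner_sub_right, real_inner_smul_right, real_inner_self_eq_norm_sq] at h1
  have h2 : 0 < t * ‖ν r‖ ^ 2 := mul_pos htpos (by positivity)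
  linarith

/-- The gradient of `½ Σ_r ℓ_r log ℓ_r` at a point where all `ℓ_r = ⟪ν r, ·⟫ - lam r` are
positive. -/
noncomputable def guilleminGradient {ι : Type*} [Fintype ι] (ν : ι → E) (lam : ι → ℝ) (x : E) :
    E :=
  (1 / 2 : ℝ) • ∑ r, (Real.log (⟪ν r, x⟫ - lam r) + 1) • ν r

lemma hasGradientAt_guillemin_add [CompleteSpace E] {ι : Type*} [Fintype ι] {ν : ι → E}
    {lam : ι → ℝ} {φ : E → ℝ} {x : E} (hpos : ∀ r, 0 < ⟪ν r, x⟫ - lam r)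
    (hφ : DifferentiableAt ℝ φ x) :
    HasGradientAt (fun y =>
      (1 / 2) * ∑ r, (⟪ν r, y⟫ - lam r) * Real.log (⟪ν r, y⟫ - lam r) + φ y)
      (guilleminGradient ν lam x + gradient φ x) x := by
  have hterm : ∀ r, HasFDerivAt
      (fun y => (⟪ν r, y⟫ - lam r) * Real.log (⟪ν r, y⟫ - lam r))
      ((Real.log (⟪ν r, x⟫ - lam r) + 1) • innerSL ℝ (ν r)) x := fun r =>
    (Real.hasDerivAt_mul_log (hpos r).ne').comp_hasFDerivAt (f := fun y => ⟪ν r, y⟫ - lam r) x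
      ((innerSL ℝ (ν r)).hasFDerivAt.sub_const (lam r))
  have hsum := (HasFDerivAt.fun_sum (u := Finset.univ) fun r _ => hterm r).const_mul (1 / 2 : ℝ)
  rw [hasGradientAt_iff_hasFDerivAt]
  refine (hsum.add hφ.hasGradientAt.hasFDerivAt).congr_fderiv ?_
  ext v
  simp [guilleminGradient]

lemma continuousAt_guilleminGradient {ι : Type*} [Fintype ι] {ν : ι → E} {lam : ι → ℝ} {x : E}
    (hpos : ∀ r, 0 < ⟪ν r, x⟫ - lam r) : ContinuousAt (guilleminGradient ν lam) x := by
  unfold guilleminGradient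
  refine ContinuousAt.const_smul (tendsto_finsetSum _ fun r _ => ?_) _
  have hl : ContinuousAt (fun y => ⟪ν r, y⟫ - lam r) x := by fun_prop
  exact ((hl.log (hpos r).ne').add continuousAt_const).smul continuousAt_const

lemma guilleminGradient_monotone {ι : Type*} [Fintype ι] {ν : ι → E} {lam : ι → ℝ} {x y : E}
    (hx : ∀ r, 0 < ⟪ν r, x⟫ - lam r) (hy : ∀ r, 0 < ⟪ν r, y⟫ - lam r) :
    0 ≤ ⟪guilleminGradient ν lam x - guilleminGradient ν lam y, x - y⟫ := by
  rw [guilleminGradient, guilleminGradient, ← smul_sub, ← Finset.sum_sub_distrib,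
    real_inner_smul_left, sum_inner]
  refine mul_nonneg (by norm_num) (Finset.sum_nonneg fun r _ => ?_)
  rw [← sub_smul, real_inner_smul_left, inner_sub_right]
  rcases le_total (⟪ν r, x⟫ - lam r) (⟪ν r, y⟫ - lam r) with h | h
  · have := Real.log_le_log (hx r) h
    exact mul_nonneg_of_nonpos_of_nonpos (by linarith) (by linarith)
  · have := Real.log_le_log (hy r) h
    exact mul_nonneg (by linarith) (by linarith)

lemma ContDiffOn.gradient_of_isOpen [CompleteSpace E] {f : E → ℝ} {U : Set E} {m k : WithTop ℕ∞}
    (hf : ContDiffOn ℝ k f U) (hU : IsOpen U) (hmk : m + 1 ≤ k) :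
    ContDiffOn ℝ m (gradient f) U :=
  (InnerProductSpace.toDual ℝ E).symm.contDiff.comp_contDiffOn (hf.fderiv_of_isOpen hU hmk)

/-- A differentiable map whose derivative is bounded below by `m` on a convex open set is
`m`-strongly monotone there. -/
lemma Convex.strongly_monotone_of_fderiv {F : E → E} {U : Set E} (hU : Convex ℝ U)
    (hF : ∀ x ∈ U, DifferentiableAt ℝ F x) {m : ℝ}
    (hm : ∀ x ∈ U, ∀ v, m * ‖v‖ ^ 2 ≤ ⟪v, fderiv ℝ F x v⟫) {x y : E} (hx : x ∈ U)
    (hy : y ∈ U) : m * ‖x - y‖ ^ 2 ≤ ⟪F x - F y, x - y⟫ := by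
  have hmem : ∀ t ∈ Icc (0 : ℝ) 1, y + t • (x - y) ∈ U := fun t ht =>
    hU.add_smul_sub_mem hy hx ht
  have hderiv : ∀ t ∈ Icc (0 : ℝ) 1, HasDerivAt (fun t : ℝ => ⟪x - y, F (y + t • (x - y))⟫)
      ⟪x - y, fderiv ℝ F (y + t • (x - y)) (x - y)⟫ t := by
    intro t ht
    have hline : HasDerivAt (fun t : ℝ => y + t • (x - y)) (x - y) t := by
      simpa using ((hasDerivAt_id t).smul_const (x - y)).const_add y
    have hcomp := (hF _ (hmem t ht)).hasFDerivAt.comp_hasDerivAt t hline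
    exact (innerSL ℝ (x - y)).hasFDerivAt.comp_hasDerivAt t hcomp
  obtain ⟨t, ht, h⟩ := exists_hasDerivAt_eq_slope _ _ (zero_lt_one' ℝ)
    (fun t ht => (hderiv t ht).continuousAt.continuousWithinAt)
    (fun t ht => hderiv t (Ioo_subset_Icc_self ht))
  have h1 := hm _ (hmem t (Ioo_subset_Icc_self ht)) (x - y)
  rw [h] at h1
  rw [real_inner_comm, inner_sub_right]
  simpa using h1

lemma tendstoUniformlyOn_add_one_div_smul {f h : E → E} {C : Set E} {M : ℝ}
    (hM : ∀ x ∈ C, ‖h x‖ ≤ M) :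
    TendstoUniformlyOn (fun (s : ℝ) x => f x + (1 / s) • h x) f atTop C := by
  rw [Metric.tendstoUniformlyOn_iff]
  intro ε hε
  filter_upwards [eventually_gt_atTop 0, eventually_gt_atTop (M / ε)] with s hs hsM x hx
  rw [dist_self_add_right, norm_smul, Real.norm_of_nonneg (by positivity), one_div_mul_eq_div,
    div_lt_iff₀ hs]
  rw [div_lt_iff₀ hε] at hsM
  linarith [hM x hx]

/-- If `f` is `m`-strongly monotone, `g` is monotone and `k` is bounded by `K`, then a solution
`x` of `f x + s⁻¹ • (g x + k x) = f y` is at distance `O(s⁻¹)` from `y`. -/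
lemma norm_sub_le_of_perturbed_eq {f g k : E → E} {x y : E} {m s K M : ℝ}
    (hs : 0 < s) (hf : m * ‖x - y‖ ^ 2 ≤ ⟪f x - f y, x - y⟫)
    (hg : 0 ≤ ⟪g x - g y, x - y⟫) (hk : ‖k x‖ ≤ K) (hM : ‖g y‖ ≤ M)
    (hxy : f x + (1 / s) • (g x + k x) = f y) : m * s * ‖x - y‖ ≤ K + M := by
  have hfs : s • (f x - f y) = -((g x - g y) + k x + g y) := by
    rw [← hxy, sub_add_cancel_left, smul_neg, smul_smul, mul_one_div_cancel hs.ne', one_smul]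
    abel
  have h1 : s * ⟪f x - f y, x - y⟫ ≤ (K + M) * ‖x - y‖ := by
    rw [← real_inner_smul_left, hfs, inner_neg_left, inner_add_left, inner_add_left]
    have h2 := (abs_le.1 (abs_real_inner_le_norm (k x) (x - y))).1
    have h3 := (abs_le.1 (abs_real_inner_le_norm (g y) (x - y))).1
    have h4 := mul_le_mul_of_nonneg_right hk (norm_nonneg (x - y))
    have h5 := mul_le_mul_of_nonneg_right hM (norm_nonneg (x - y))
    linarith
  rcases (norm_nonneg (x - y)).eq_or_lt with h0 | h0
  · rw [← h0, mul_zero]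
    exact add_nonneg ((norm_nonneg _).trans hk) ((norm_nonneg _).trans hM)
  · refine le_of_mul_le_mul_right ?_ h0
    nlinarith [mul_le_mul_of_nonneg_left hf hs.le]

end Legendre

/-- convergence of the rescaled Legendre transforms.
Let `P = {x : ℓ_r(x) ≥ 0, r = 1,…,d}` be a compact simple polytope with nonempty interior,
`g_P(x) = ½ Σ_r ℓ_r(x) log ℓ_r(x)` the Guillemin potential, `φ` smooth on an open
neighborhood of `P`, and `ψ` of class `C²` on an open convex neighborhood `U` of `P` with
`Hess ψ ≥ 2c·Id` on `U` for some `c > 0`.  Set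
`κ_s(x) = ∇ψ(x) + (1/s)∇(g_P + φ)(x)` for `s > 0`.  Then `κ_s → ∇ψ` pointwise on `int P`
and uniformly on every compact `C ⊆ int P`; moreover, if each `κ_s : int P → ℝⁿ` (`s > 0`)
is a bijection, the inverses `κ_s⁻¹` converge uniformly on `∇ψ(C)` to the inverse of
`∇ψ|_{int P}`, for every compact `C ⊆ int P`. -/
theorem kappa_converges_to_legendre {n d : ℕ}
    (ν : Fin d → EuclideanSpace ℝ (Fin n)) (lam : Fin d → ℝ)
    (P : Set (EuclideanSpace ℝ (Fin n)))
    (hPdef : P = {x | ∀ r, 0 ≤ ⟪ν r, x⟫ - lam r})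
    (hPcomp : IsCompact P) (hPint : (interior P).Nonempty)
    (hsimple : ∀ p ∈ P,
      LinearIndependent ℝ (fun r : {r : Fin d // ⟪ν r, p⟫ - lam r = 0} => ν r.1))
    (φ : EuclideanSpace ℝ (Fin n) → ℝ)
    (V : Set (EuclideanSpace ℝ (Fin n))) (hVopen : IsOpen V) (hPV : P ⊆ V)
    (hφ : ContDiffOn ℝ (⊤ : ℕ∞) φ V)
    (U : Set (EuclideanSpace ℝ (Fin n))) (hUopen : IsOpen U) (hUconv : Convex ℝ U)
    (hPU : P ⊆ U)
    (ψ : EuclideanSpace ℝ (Fin n) → ℝ) (hψ : ContDiffOn ℝ 2 ψ U)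
    (c : ℝ) (hc : 0 < c)
    (hHess : ∀ x ∈ U, ∀ v : EuclideanSpace ℝ (Fin n),
      2 * c * ‖v‖ ^ 2 ≤ ⟪v, fderiv ℝ (gradient ψ) x v⟫)
    (κ : ℝ → EuclideanSpace ℝ (Fin n) → EuclideanSpace ℝ (Fin n))
    (hκ : ∀ s x, κ s x = gradient ψ x + (1 / s) •
      gradient (fun y =>
        (1 / 2) * ∑ r, (⟪ν r, y⟫ - lam r) * Real.log (⟪ν r, y⟫ - lam r) + φ y) x) :
    (∀ x ∈ interior P, Tendsto (fun s : ℝ => κ s x) atTop (𝓝 (gradient ψ x))) ∧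
    (∀ C ⊆ interior P, IsCompact C →
      TendstoUniformlyOn κ (gradient ψ) atTop C) ∧
    ((∀ s : ℝ, 0 < s → BijOn (κ s) (interior P) univ) →
      ∀ C ⊆ interior P, IsCompact C →
        TendstoUniformlyOn (fun (s : ℝ) (y : EuclideanSpace ℝ (Fin n)) =>
            Function.invFunOn (κ s) (interior P) y)
          (Function.invFunOn (gradient ψ) (interior P)) atTop
          (gradient ψ '' C)) := by
  have hpos : ∀ x ∈ interior P, ∀ r, 0 < ⟪ν r, x⟫ - lam r := fun x hx r =>
    polyhedron_interior_pos (hPdef ▸ hx) r fun h0 =>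
      (hsimple x (interior_subset hx)).ne_zero ⟨r, h0⟩
  have hgradφ : ContinuousOn (gradient φ) V :=
    (hφ.gradient_of_isOpen (m := 0) hVopen (by simp)).continuousOn
  have hκ' : ∀ s, ∀ x ∈ interior P,
      κ s x = gradient ψ x + (1 / s) • (guilleminGradient ν lam x + gradient φ x) := by
    intro s x hx
    have hd : DifferentiableAt ℝ φ x := (hφ.contDiffAt
      (hVopen.mem_nhds (hPV (interior_subset hx)))).differentiableAt (by simp)
    rw [hκ, (hasGradientAt_guillemin_add (hpos x hx) hd).gradient]
  have hcontG : ContinuousOn (guilleminGradient ν lam) (interior P) := fun x hx =>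
    (continuousAt_guilleminGradient (hpos x hx)).continuousWithinAt
  have hunif : ∀ C ⊆ interior P, IsCompact C → TendstoUniformlyOn κ (gradient ψ) atTop C := by
    intro C hC hCc
    obtain ⟨M, hM⟩ := hCc.exists_bound_of_continuousOn
      ((hcontG.mono hC).add (hgradφ.mono (hC.trans (interior_subset.trans hPV))))
    exact (tendstoUniformlyOn_add_one_div_smul hM).congr
      (Eventually.of_forall fun s x hx => (hκ' s x (hC hx)).symm)
  refine ⟨fun x hx => (hunif {x} (by simpa using hx) isCompact_singleton).tendsto_at rfl,
    hunif, fun hbij C hC hCc => ?_⟩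
  have hdiff : ∀ x ∈ U, DifferentiableAt ℝ (gradient ψ) x := fun x hx =>
    ((hψ.gradient_of_isOpen (m := 1) hUopen (by norm_num)).contDiffAt
      (hUopen.mem_nhds hx)).differentiableAt (by simp)
  have hmono : ∀ x ∈ interior P, ∀ y ∈ interior P,
      2 * c * ‖x - y‖ ^ 2 ≤ ⟪gradient ψ x - gradient ψ y, x - y⟫ := fun x hx y hy =>
    hUconv.strongly_monotone_of_fderiv hdiff hHess (hPU (interior_subset hx))
      (hPU (interior_subset hy))
  have hinj : InjOn (gradient ψ) (interior P) := by
    intro x hx y hy hxy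
    have h := hmono x hx y hy
    rw [hxy, sub_self, inner_zero_left] at h
    by_contra hne
    have : 0 < ‖x - y‖ := norm_pos_iff.2 (sub_ne_zero.2 hne)
    have : 0 < 2 * c * ‖x - y‖ ^ 2 := by positivity
    linarith
  obtain ⟨K, hK⟩ := hPcomp.exists_bound_of_continuousOn (hgradφ.mono hPV)
  obtain ⟨M, hM⟩ := hCc.exists_bound_of_continuousOn (hcontG.mono hC)
  rw [Metric.tendstoUniformlyOn_iff]
  intro ε hε
  filter_upwards [eventually_gt_atTop 0, eventually_gt_atTop ((K + M) / (2 * c * ε))]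
    with s hs hsε
  rintro _ ⟨y, hy, rfl⟩
  have hex : ∃ x ∈ interior P, κ s x = gradient ψ y := (hbij s hs).surjOn (mem_univ _)
  have hx := Function.invFunOn_mem hex
  have hxy := Function.invFunOn_eq hex
  rw [hinj.leftInvOn_invFunOn (hC hy), dist_comm, dist_eq_norm]
  rw [hκ' s _ hx] at hxy
  have hle := norm_sub_le_of_perturbed_eq hs (hmono _ hx y (hC hy))
    (guilleminGradient_monotone (hpos _ hx) (hpos y (hC hy)))
    (hK _ (interior_subset hx)) (hM y hy) hxy
  rw [div_lt_iff₀ (by positivity)] at hsε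
  have hcs : 0 < 2 * c * s := by positivity
  refine lt_of_mul_lt_mul_left ?_ hcs.le
  linarith
end

section
/- Let p ∈ ∂P and let c ∈ ℝⁿ with c ∉ C_p(P). Then there is an open neighborhood U of p such that for every x ∈ U ∩ int P the rays ℝ≥0·∇(g_P + φ)(x) and ℝ≥0·c are distinct. (In other words, along any sequence x_k ∈ int P with x_k → p ∈ ∂P, the gradients ∇(g_P + φ)(x_k) tend directionally into the normal cone C_p(P).) -/
open Filter Set
open scoped RealInnerProductSpace Topology BigOperators

/-- The directional derivative of the symplectic potential at a point where every defining
affine function is nonzero. -/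
lemma inner_gradient_potential {n d : ℕ}
    (ν : Fin d → EuclideanSpace ℝ (Fin n)) (lam : Fin d → ℝ)
    {φ : EuclideanSpace ℝ (Fin n) → ℝ} {x : EuclideanSpace ℝ (Fin n)}
    (hφ : DifferentiableAt ℝ φ x) (hx : ∀ r, ⟪ν r, x⟫ - lam r ≠ 0)
    (w : EuclideanSpace ℝ (Fin n)) :
    ⟪gradient (fun z =>
      (1 / 2) * ∑ r, (⟪ν r, z⟫ - lam r) * Real.log (⟪ν r, z⟫ - lam r) + φ z) x, w⟫ =
      (1 / 2) * ∑ r, (Real.log (⟪ν r, x⟫ - lam r) + 1) * ⟪ν r, w⟫ + fderiv ℝ φ x w := by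
  have hterm : ∀ r, HasFDerivAt
      (fun z => (⟪ν r, z⟫ - lam r) * Real.log (⟪ν r, z⟫ - lam r))
      ((Real.log (⟪ν r, x⟫ - lam r) + 1) • innerSL ℝ (ν r)) x := fun r =>
    HasDerivAt.comp_hasFDerivAt (h₂ := fun u => u * Real.log u) x
      (Real.hasDerivAt_mul_log (hx r))
      ((innerSL ℝ (ν r)).hasFDerivAt.sub_const (lam r))
  have hsum := ((HasFDerivAt.fun_sum (u := Finset.univ) fun r _ => hterm r).const_mul
    (1 / 2 : ℝ)).add hφ.hasFDerivAt
  have hfd := hsum.fderiv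
  rw [inner_gradient_left]
  refine (DFunLike.congr_fun hfd w).trans ?_
  simp

/-- A finite sum of real functions, one of which tends to `-∞` while all are eventually
bounded above, tends to `-∞`. -/
lemma tendsto_sum_atBot_of_eventually_le {α ι : Type*} [Fintype ι] {l : Filter α}
    {f : ι → α → ℝ} {i : ι} (hi : Tendsto (f i) l atBot)
    (hf : ∀ j, ∃ C, ∀ᶠ x in l, f j x ≤ C) :
    Tendsto (fun x => ∑ j, f j x) l atBot := by
  classical
  choose C hC using hf
  refine tendsto_atBot_mono' l ?_
    (tendsto_atBot_add_const_right l (∑ j ∈ Finset.univ.erase i, C j) hi)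
  filter_upwards [eventually_all.2 hC] with x hx
  rw [← Finset.add_sum_erase _ _ (Finset.mem_univ i)]
  gcongr with j
  exact hx j

/-- directional behavior of the gradient of the symplectic potential at the
boundary.  Let `P = {x : ℓ_r(x) ≥ 0}` be a compact simple polytope with nonempty interior,
`g_P` the Guillemin potential and `φ` a `C¹` function on an open neighborhood of `P`.
Let `p ∈ ∂P` and `c ∈ ℝⁿ` with `c ∉ C_p(P)` (the normal cone of `P` at `p`).  Then there is
an open neighborhood `U` of `p` such that for every `x ∈ U ∩ int P` the rays
`ℝ≥0·∇(g_P + φ)(x)` and `ℝ≥0·c` are distinct. -/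
theorem gradient_tends_into_normal_cone {n d : ℕ}
    (ν : Fin d → EuclideanSpace ℝ (Fin n)) (lam : Fin d → ℝ)
    (P : Set (EuclideanSpace ℝ (Fin n)))
    (hPdef : P = {x | ∀ r, 0 ≤ ⟪ν r, x⟫ - lam r})
    (hPcomp : IsCompact P) (hPint : (interior P).Nonempty)
    (hsimple : ∀ q ∈ P,
      LinearIndependent ℝ (fun r : {r : Fin d // ⟪ν r, q⟫ - lam r = 0} => ν r.1))
    (φ : EuclideanSpace ℝ (Fin n) → ℝ)
    (V : Set (EuclideanSpace ℝ (Fin n))) (hVopen : IsOpen V) (hPV : P ⊆ V)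
    (hφ : ContDiffOn ℝ 1 φ V)
    (p : EuclideanSpace ℝ (Fin n)) (hp : p ∈ frontier P)
    (c : EuclideanSpace ℝ (Fin n))
    (hc : c ∉ {c' : EuclideanSpace ℝ (Fin n) | ∀ p' ∈ P, 0 ≤ ⟪c', p - p'⟫}) :
    ∃ U : Set (EuclideanSpace ℝ (Fin n)), IsOpen U ∧ p ∈ U ∧
      ∀ x ∈ U ∩ interior P,
        {y | ∃ t : ℝ, 0 ≤ t ∧ y = t •
            gradient (fun z =>
              (1 / 2) * ∑ r, (⟪ν r, z⟫ - lam r) * Real.log (⟪ν r, z⟫ - lam r) + φ z) x}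
          ≠ {y | ∃ t : ℝ, 0 ≤ t ∧ y = t • c} := by
  have hcont : ∀ r, Continuous fun x => ⟪ν r, x⟫ - lam r := fun r => by fun_prop
  have hpP : p ∈ P := hPcomp.isClosed.frontier_subset hp
  have hmem : ∀ x, x ∈ P ↔ ∀ r, 0 ≤ ⟪ν r, x⟫ - lam r := fun x => by rw [hPdef]; rfl
  have hconv : Convex ℝ P := by
    intro x hx y hy a b ha hb hab
    rw [hmem] at hx hy ⊢
    intro r
    have h : ⟪ν r, a • x + b • y⟫ - lam r =
        a * (⟪ν r, x⟫ - lam r) + b * (⟪ν r, y⟫ - lam r) := by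
      rw [inner_add_right, inner_smul_right, inner_smul_right]
      linear_combination lam r * hab
    rw [h]
    exact add_nonneg (mul_nonneg ha (hx r)) (mul_nonneg hb (hy r))
  have hpos : ∀ x ∈ interior P, ∀ r, 0 < ⟪ν r, x⟫ - lam r := by
    intro x hx r
    refine ((hmem x).1 (interior_subset hx) r).lt_of_ne' fun h0 => ?_
    have hν : ν r ≠ 0 := (hsimple x (interior_subset hx)).ne_zero ⟨r, h0⟩
    have hlim : Tendsto (fun t : ℝ => x - t • ν r) (𝓝[>] 0) (𝓝 x) := by
      have : Continuous fun t : ℝ => x - t • ν r := by fun_prop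
      simpa using (this.tendsto 0).mono_left nhdsWithin_le_nhds
    obtain ⟨t, htP, ht⟩ := ((hlim.eventually_mem (mem_interior_iff_mem_nhds.1 hx)).and
      self_mem_nhdsWithin).exists
    have h1 := (hmem _).1 htP r
    rw [inner_sub_right, inner_smul_right] at h1
    have h2 : 0 < t * ⟪ν r, ν r⟫ := mul_pos ht (real_inner_self_pos.2 hν)
    linarith
  obtain ⟨r₀, hr₀⟩ : ∃ r, ⟪ν r, p⟫ - lam r = 0 := by
    by_contra! h
    refine hp.2 (mem_interior_iff_mem_nhds.2 ?_)
    have : ∀ᶠ x in 𝓝 p, ∀ r, 0 < ⟪ν r, x⟫ - lam r := eventually_all.2 fun r =>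
      (hcont r).continuousAt.eventually (lt_mem_nhds (((hmem p).1 hpP r).lt_of_ne' (h r)))
    filter_upwards [this] with x hx
    exact (hmem x).2 fun r => (hx r).le
  obtain ⟨q, hcq, hq⟩ : ∃ q, 0 < ⟪c, q - p⟫ ∧ q ∈ interior P := by
    simp only [mem_ofPred_eq, not_forall, not_le] at hc
    obtain ⟨p', hp', hlt⟩ := hc
    have hcl : p' ∈ closure (interior P) := by
      rw [hconv.closure_interior_eq_closure_of_nonempty_interior hPint]
      exact subset_closure hp'
    have hopen : IsOpen {y | 0 < ⟪c, y - p⟫} :=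
      isOpen_lt continuous_const (by fun_prop)
    have hcp : 0 < ⟪c, p' - p⟫ := by
      rw [← neg_sub p p', inner_neg_right]
      linarith
    exact mem_closure_iff.1 hcl _ hopen hcp
  have hactive : ∀ r, ⟪ν r, p⟫ - lam r = 0 → Tendsto
      (fun x => (Real.log (⟪ν r, x⟫ - lam r) + 1) * ⟪ν r, q - p⟫)
      (𝓝[interior P] p) atBot := by
    intro r hr
    have hw : 0 < ⟪ν r, q - p⟫ := by
      have := hpos q hq r
      rw [inner_sub_right]
      linarith
    refine Tendsto.atBot_mul_const hw (tendsto_atBot_add_const_right _ _ ?_)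
    refine Real.tendsto_log_nhdsNE_zero.comp (tendsto_nhdsWithin_iff.2 ⟨?_, ?_⟩)
    · simpa only [hr] using ((hcont r).tendsto p).mono_left nhdsWithin_le_nhds
    · filter_upwards [self_mem_nhdsWithin] with x hx
      exact (hpos x hx r).ne'
  have hbdd : ∀ r, ∃ C, ∀ᶠ x in 𝓝[interior P] p,
      (Real.log (⟪ν r, x⟫ - lam r) + 1) * ⟪ν r, q - p⟫ ≤ C := by
    intro r
    by_cases hr : ⟪ν r, p⟫ - lam r = 0
    · exact ⟨0, (hactive r hr).eventually_le_atBot 0⟩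
    · have hca : ContinuousAt
          (fun x => (Real.log (⟪ν r, x⟫ - lam r) + 1) * ⟪ν r, q - p⟫) p :=
        (((hcont r).continuousAt.log hr).add continuousAt_const).mul continuousAt_const
      exact ((hca.tendsto.mono_left nhdsWithin_le_nhds).isBoundedUnder_le)
  have hφlim : Tendsto (fun x => fderiv ℝ φ x (q - p)) (𝓝[interior P] p)
      (𝓝 (fderiv ℝ φ p (q - p))) :=
    (((hφ.continuousOn_fderiv_of_isOpen hVopen le_rfl).continuousAt
      (hVopen.mem_nhds (hPV hpP))).clm_apply continuousAt_const).tendsto.mono_left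
      nhdsWithin_le_nhds
  have hlim := ((tendsto_sum_atBot_of_eventually_le (hactive r₀ hr₀) hbdd).const_mul_atBot
    (one_half_pos (α := ℝ))).atBot_add hφlim
  obtain ⟨U, hU, hpU, hUneg⟩ := mem_nhdsWithin.1 (hlim.eventually_lt_atBot 0)
  refine ⟨U, hU, hpU, fun x hx heq => ?_⟩
  obtain ⟨t, ht, hct⟩ := heq.ge (show c ∈ {y | ∃ t : ℝ, 0 ≤ t ∧ y = t • c} from
    ⟨1, zero_le_one, (one_smul ℝ c).symm⟩)
  have hdiff : DifferentiableAt ℝ φ x :=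
    (hφ.differentiableOn one_ne_zero).differentiableAt
      (hVopen.mem_nhds (hPV (interior_subset hx.2)))
  rw [hct, real_inner_smul_left, inner_gradient_potential ν lam hdiff
    fun r => (hpos x hx.2 r).ne'] at hcq
  exact hcq.not_ge (mul_nonpos_of_nonneg_of_nonpos ht (hUneg hx).le)
end

section
/- For every p′ ∈ P and every δ > 0 there exist ε > 0 and s₀ ≥ 0 such that for every p ∈ P with ‖p − p′‖ ≥ δ and every s ≥ s₀, the closure of κ_s(B_ε(p′) ∩ int P) is disjoint from the set ∇ψ(p) + C_p(P). -/
open Filter Set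
open scoped RealInnerProductSpace Topology BigOperators

theorem log_add_one_mul_sub_le {a b M : ℝ} (ha : 0 < a) (haM : a ≤ M) (hb : 0 ≤ b) (hbM : b ≤ M) :
    (Real.log a + 1) * (b - a) ≤ M ^ 2 + M + 1 := by
  have h1 : Real.log a ≤ M := by linarith [Real.log_le_sub_one_of_pos ha]
  have h2 : b * Real.log a ≤ M ^ 2 := by nlinarith
  have h3 : a * (1 - a⁻¹) ≤ a * Real.log a :=
    mul_le_mul_of_nonneg_left (Real.one_sub_inv_le_log_of_pos ha) ha.le
  have h4 : a * (1 - a⁻¹) = a - 1 := by field_simp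
  nlinarith

theorem Convex.mul_sq_norm_sub_le_inner_sub_of_fderiv {E : Type*} [NormedAddCommGroup E]
    [InnerProductSpace ℝ E] {U : Set E} (hU : Convex ℝ U) {F : E → E}
    (hF : ∀ x ∈ U, DifferentiableAt ℝ F x) {m : ℝ}
    (hm : ∀ x ∈ U, ∀ v : E, m * ‖v‖ ^ 2 ≤ ⟪v, fderiv ℝ F x v⟫) {x y : E} (hx : x ∈ U)
    (hy : y ∈ U) : m * ‖y - x‖ ^ 2 ≤ ⟪F y - F x, y - x⟫ := by
  have hmem : ∀ t ∈ Icc (0 : ℝ) 1, x + t • (y - x) ∈ U := fun t ht =>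
    hU.add_smul_sub_mem hx hy ht
  have hd : ∀ t ∈ Icc (0 : ℝ) 1, HasDerivAt (fun t : ℝ => ⟪y - x, F (x + t • (y - x))⟫)
      ⟪y - x, fderiv ℝ F (x + t • (y - x)) (y - x)⟫ t := by
    intro t ht
    have hline : HasDerivAt (fun t : ℝ => x + t • (y - x)) (y - x) t := by
      simpa using ((hasDerivAt_id t).smul_const (y - x)).const_add x
    have h := (hF _ (hmem t ht)).hasFDerivAt.comp_hasDerivAt t hline
    simpa using (hasDerivAt_const t (y - x)).inner ℝ h
  have h := (convex_Icc (0 : ℝ) 1).mul_sub_le_image_sub_of_le_deriv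
    (fun t ht => (hd t ht).continuousAt.continuousWithinAt)
    (fun t ht => (hd t (interior_subset ht)).differentiableAt.differentiableWithinAt)
    (C := m * ‖y - x‖ ^ 2)
    (fun t ht => by
      rw [(hd t (interior_subset ht)).deriv]
      exact hm _ (hmem t (interior_subset ht)) _)
    0 (by simp) 1 (by simp) zero_le_one
  rw [real_inner_comm, inner_sub_right]
  simpa using h

theorem inner_gradient_eq_fderiv {E : Type*} [NormedAddCommGroup E] [InnerProductSpace ℝ E]
    [CompleteSpace E] (f : E → ℝ) (x v : E) : ⟪gradient f x, v⟫ = fderiv ℝ f x v := by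
  simp [gradient]

theorem ContDiffAt.gradient {E : Type*} [NormedAddCommGroup E] [InnerProductSpace ℝ E]
    [CompleteSpace E] {f : E → ℝ} {x : E} {k m : WithTop ℕ∞} (hf : ContDiffAt ℝ k f x)
    (hk : m + 1 ≤ k) : ContDiffAt ℝ m (gradient f) x :=
  (InnerProductSpace.toDual ℝ E).symm.contDiff.contDiffAt.comp x (hf.fderiv_right hk)

theorem inner_sub_pos_of_mem_interior {E ι : Type*} [NormedAddCommGroup E]
    [InnerProductSpace ℝ E] {ν : ι → E} {lam : ι → ℝ}
    (hsimple : ∀ q ∈ {x | ∀ r, 0 ≤ ⟪ν r, x⟫ - lam r},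
      LinearIndependent ℝ (fun r : {r : ι // ⟪ν r, q⟫ - lam r = 0} => ν r.1))
    {x : E} (hx : x ∈ interior {x | ∀ r, 0 ≤ ⟪ν r, x⟫ - lam r}) (r : ι) :
    0 < ⟪ν r, x⟫ - lam r := by
  have hxP := interior_subset hx
  refine lt_of_le_of_ne (hxP r) fun h0 => ?_
  have hν : ν r ≠ 0 := (hsimple x hxP).ne_zero ⟨r, h0.symm⟩
  have hlim : Tendsto (fun t : ℝ => x - t • ν r) (𝓝[>] 0) (𝓝 x) := by
    have : Continuous fun t : ℝ => x - t • ν r := by fun_prop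
    simpa using (this.tendsto 0).mono_left nhdsWithin_le_nhds
  obtain ⟨t, ht, htpos⟩ :=
    ((hlim.eventually (mem_interior_iff_mem_nhds.mp hx)).and self_mem_nhdsWithin).exists
  have h := ht r
  rw [inner_sub_right, inner_smul_right, real_inner_self_eq_norm_sq] at h
  have : 0 < t * ‖ν r‖ ^ 2 := mul_pos htpos (by positivity)
  linarith

theorem inner_gradient_guillemin_add {E ι : Type*} [Fintype ι] [NormedAddCommGroup E]
    [InnerProductSpace ℝ E] [CompleteSpace E] {ν : ι → E} {lam : ι → ℝ} {φ : E → ℝ} {x : E}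
    (hpos : ∀ r, 0 < ⟪ν r, x⟫ - lam r) (hφ : DifferentiableAt ℝ φ x) (v : E) :
    ⟪gradient (fun y =>
      (1 / 2) * ∑ r, (⟪ν r, y⟫ - lam r) * Real.log (⟪ν r, y⟫ - lam r) + φ y) x, v⟫ =
      (1 / 2) * ∑ r, (Real.log (⟪ν r, x⟫ - lam r) + 1) * ⟪ν r, v⟫ + ⟪gradient φ x, v⟫ := by
  have hℓ : ∀ r, HasFDerivAt (fun y => ⟪ν r, y⟫ - lam r) (innerSL ℝ (ν r)) x := fun r =>
    (innerSL ℝ (ν r)).hasFDerivAt.sub_const _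
  have hterm : ∀ r, HasFDerivAt (fun y => (⟪ν r, y⟫ - lam r) * Real.log (⟪ν r, y⟫ - lam r))
      ((Real.log (⟪ν r, x⟫ - lam r) + 1) • innerSL ℝ (ν r)) x := fun r =>
    (Real.hasDerivAt_mul_log (hpos r).ne').comp_hasFDerivAt
      (f := fun y => ⟪ν r, y⟫ - lam r) x (hℓ r)
  have h := ((HasFDerivAt.fun_sum fun r (_ : r ∈ Finset.univ) => hterm r).const_mul
    (1 / 2 : ℝ)).fun_add hφ.hasFDerivAt
  rw [inner_gradient_eq_fderiv, inner_gradient_eq_fderiv, h.fderiv]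
  simp

theorem exists_forall_inner_gradient_guillemin_add_le {E ι : Type*} [Fintype ι]
    [NormedAddCommGroup E] [InnerProductSpace ℝ E] [CompleteSpace E] {ν : ι → E} {lam : ι → ℝ}
    {P : Set E} (hPdef : P = {x | ∀ r, 0 ≤ ⟪ν r, x⟫ - lam r}) (hPcomp : IsCompact P)
    (hsimple : ∀ q ∈ P,
      LinearIndependent ℝ (fun r : {r : ι // ⟪ν r, q⟫ - lam r = 0} => ν r.1))
    {φ : E → ℝ} (hφ : ∀ x ∈ P, ContDiffAt ℝ 1 φ x) :
    ∃ K : ℝ, 0 ≤ K ∧ ∀ x ∈ interior P, ∀ p ∈ P,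
      ⟪gradient (fun y =>
        (1 / 2) * ∑ r, (⟪ν r, y⟫ - lam r) * Real.log (⟪ν r, y⟫ - lam r) + φ y) x, p - x⟫ ≤ K := by
  obtain ⟨D, hD⟩ := hPcomp.isBounded.exists_norm_le
  have hgrad : ContinuousOn (gradient φ) P := fun x hx =>
    ((hφ x hx).gradient (m := 0) (by simp)).continuousAt.continuousWithinAt
  obtain ⟨G, hG⟩ := (hPcomp.image_of_continuousOn hgrad).isBounded.exists_norm_le
  have hM : ∀ r, ∃ M, ∀ x ∈ P, ⟪ν r, x⟫ - lam r ≤ M := fun r => by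
    obtain ⟨M, hM⟩ := hPcomp.bddAbove_image (f := fun x => ⟪ν r, x⟫ - lam r) (by fun_prop)
    exact ⟨M, fun x hx => hM (mem_image_of_mem _ hx)⟩
  choose M hM using hM
  refine ⟨max 0 ((1 / 2) * ∑ r, (M r ^ 2 + M r + 1) + G * (D + D)), le_max_left _ _,
    fun x hx p hp => le_max_of_le_right ?_⟩
  have hxP := interior_subset hx
  have hpos : ∀ r, 0 < ⟪ν r, x⟫ - lam r := by
    subst hPdef
    exact inner_sub_pos_of_mem_interior hsimple hx
  rw [inner_gradient_guillemin_add hpos ((hφ x hxP).differentiableAt (by simp))]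
  have hGx := hG _ (mem_image_of_mem _ hxP)
  gcongr with r
  · have hpr : 0 ≤ ⟪ν r, p⟫ - lam r := by
      rw [hPdef] at hp
      exact hp r
    have h := log_add_one_mul_sub_le (hpos r) (hM r x hxP) hpr (hM r p hp)
    rwa [sub_sub_sub_cancel_right, ← inner_sub_right] at h
  · calc ⟪gradient φ x, p - x⟫ ≤ ‖gradient φ x‖ * ‖p - x‖ := real_inner_le_norm _ _
      _ ≤ G * (D + D) := by
        have := norm_sub_le p x
        have := hD p hp
        have := hD x hxP
        exact mul_le_mul hGx (by linarith) (norm_nonneg _) ((norm_nonneg _).trans hGx)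

/-- separation of images of the rescaled Legendre transforms from
translated normal cones.  Let `P` be a compact simple polytope with nonempty interior,
`g_P` the Guillemin potential, `φ` smooth near `P`, `ψ` a `C²` function on an open convex
neighborhood `U` of `P` with `Hess ψ ≥ 2c·Id`, and
`κ_s = ∇ψ + (1/s)∇(g_P + φ)` on `int P`.  Then for every `p′ ∈ P` and `δ > 0` there exist
`ε > 0` and `s₀ ≥ 0` such that for every `p ∈ P` with `‖p − p′‖ ≥ δ` and every `s ≥ s₀`,
the closure of `κ_s(B_ε(p′) ∩ int P)` is disjoint from `∇ψ(p) + C_p(P)`. -/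
theorem kappa_image_avoids_normal_cones {n d : ℕ}
    (ν : Fin d → EuclideanSpace ℝ (Fin n)) (lam : Fin d → ℝ)
    (P : Set (EuclideanSpace ℝ (Fin n)))
    (hPdef : P = {x | ∀ r, 0 ≤ ⟪ν r, x⟫ - lam r})
    (hPcomp : IsCompact P) (hPint : (interior P).Nonempty)
    (hsimple : ∀ q ∈ P,
      LinearIndependent ℝ (fun r : {r : Fin d // ⟪ν r, q⟫ - lam r = 0} => ν r.1))
    (φ : EuclideanSpace ℝ (Fin n) → ℝ)
    (V : Set (EuclideanSpace ℝ (Fin n))) (hVopen : IsOpen V) (hPV : P ⊆ V)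
    (hφ : ContDiffOn ℝ (⊤ : ℕ∞) φ V)
    (U : Set (EuclideanSpace ℝ (Fin n))) (hUopen : IsOpen U) (hUconv : Convex ℝ U)
    (hPU : P ⊆ U)
    (ψ : EuclideanSpace ℝ (Fin n) → ℝ) (hψ : ContDiffOn ℝ 2 ψ U)
    (c : ℝ) (hc : 0 < c)
    (hHess : ∀ x ∈ U, ∀ v : EuclideanSpace ℝ (Fin n),
      2 * c * ‖v‖ ^ 2 ≤ ⟪v, fderiv ℝ (gradient ψ) x v⟫)
    (κ : ℝ → EuclideanSpace ℝ (Fin n) → EuclideanSpace ℝ (Fin n))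
    (hκ : ∀ s x, κ s x = gradient ψ x + (1 / s) •
      gradient (fun y =>
        (1 / 2) * ∑ r, (⟪ν r, y⟫ - lam r) * Real.log (⟪ν r, y⟫ - lam r) + φ y) x) :
    ∀ p' ∈ P, ∀ δ : ℝ, 0 < δ →
      ∃ ε > (0 : ℝ), ∃ s₀ : ℝ, 0 ≤ s₀ ∧
        ∀ p ∈ P, δ ≤ ‖p - p'‖ → ∀ s : ℝ, s₀ ≤ s →
          Disjoint (closure (κ s '' (Metric.ball p' ε ∩ interior P)))
            {y | y - gradient ψ p ∈
              {c' : EuclideanSpace ℝ (Fin n) | ∀ q ∈ P, 0 ≤ ⟪c', p - q⟫}} := by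
  intro p' hp' δ hδ
  have hφ' : ∀ x ∈ P, ContDiffAt ℝ 1 φ x := fun x hx =>
    (hφ.contDiffAt (hVopen.mem_nhds (hPV hx))).of_le (by exact_mod_cast le_top)
  have hmono : ∀ x ∈ P, ∀ p ∈ P,
      2 * c * ‖p - x‖ ^ 2 ≤ ⟪gradient ψ p - gradient ψ x, p - x⟫ := fun x hx p hp =>
    hUconv.mul_sq_norm_sub_le_inner_sub_of_fderiv
      (fun z hz => ((hψ.contDiffAt (hUopen.mem_nhds hz)).gradient (m := 1)
        (by norm_num)).differentiableAt (by simp)) hHess (hPU hx) (hPU hp)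
  obtain ⟨K, hK0, hK⟩ :=
    exists_forall_inner_gradient_guillemin_add_le hPdef hPcomp hsimple hφ'
  obtain ⟨D, hD⟩ := Metric.isBounded_iff.mp hPcomp.isBounded
  have hη : 0 < c * (δ / 2) ^ 2 := by positivity
  refine ⟨δ / 2, half_pos hδ, K / (c * (δ / 2) ^ 2) + 1, by positivity, fun p hp hpδ s hs => ?_⟩
  have hspos : 0 < s := lt_of_lt_of_le (by positivity) hs
  have hKs : 1 / s * K ≤ c * (δ / 2) ^ 2 := by
    rw [one_div_mul_eq_div, div_le_iff₀ hspos]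
    rw [← div_le_iff₀' hη]
    linarith
  have hbound : ∀ x ∈ Metric.ball p' (δ / 2) ∩ interior P,
      ⟪κ s x - gradient ψ p, p - x⟫ ≤ -(c * (δ / 2) ^ 2) := by
    rintro x ⟨hxball, hx⟩
    have hdist : δ / 2 ≤ ‖p - x‖ := by
      rw [Metric.mem_ball, dist_eq_norm] at hxball
      linarith [norm_sub_le_norm_sub_add_norm_sub p x p']
    have hsq : c * (δ / 2) ^ 2 ≤ c * ‖p - x‖ ^ 2 := by gcongr
    have hψx := hmono x (interior_subset hx) p hp
    have hgx := (mul_le_mul_of_nonneg_left (hK x hx p hp) (one_div_pos.mpr hspos).le).trans hKs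
    rw [hκ, add_sub_right_comm, inner_add_left, real_inner_smul_left,
      ← neg_sub (gradient ψ p), inner_neg_left]
    linarith
  rw [Set.disjoint_left]
  intro y hy hycone
  obtain ⟨_, ⟨x, hx, rfl⟩, hxy⟩ :=
    Metric.mem_closure_iff.mp hy (c * (δ / 2) ^ 2 / (|D| + 1)) (by positivity)
  have hxP := interior_subset hx.2
  have hcone : 0 ≤ ⟪y - gradient ψ p, p - x⟫ := hycone x hxP
  have hdiff : ⟪y - κ s x, p - x⟫ < c * (δ / 2) ^ 2 := by
    have hpx : ‖p - x‖ ≤ |D| := by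
      rw [← dist_eq_norm]
      exact (hD hp hxP).trans (le_abs_self D)
    rw [dist_eq_norm, lt_div_iff₀ (by positivity)] at hxy
    calc ⟪y - κ s x, p - x⟫ ≤ ‖y - κ s x‖ * ‖p - x‖ := real_inner_le_norm _ _
      _ ≤ ‖y - κ s x‖ * (|D| + 1) := by gcongr; linarith
      _ < c * (δ / 2) ^ 2 := hxy
  have hsum := inner_add_left (𝕜 := ℝ) (y - κ s x) (κ s x - gradient ψ p) (p - x)
  rw [sub_add_sub_cancel] at hsum
  linarith [hbound x hx]
end
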